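/- Let V ∈ L¹(ℝ³) with ∫V = 1 and set V_α(x) = α^{−3}V(x/α) for α > 0. Then there exists β_α → 0 as α → 0 such that for all φ, ψ ∈ L²(ℝ⁶): |⟨φ, (V_α(x₁−x₂) − δ(x₁−x₂))ψ⟩| ≤ C β_α ⟨ψ, ((∇₁·∇₂)² − Δ₁ − Δ₂ + 1)ψ⟩^{1/2} ⟨φ, ((∇₁−∇₂)⁴ + (∇₁+∇₂)² + 1)φ⟩^{1/2}. -/

import Mathlib

open MeasureTheory Filter
open scoped ComplexConjugate Topology

noncomputable section

abbrev E3 := EuclideanSpace ℝ (Fin 3)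
abbrev E6 := E3 × E3

/-- Second directional derivative. -/
def D2 {X : Type*} [NormedAddCommGroup X] [NormedSpace ℝ X]
    (f : X → ℂ) (x v w : X) : ℂ :=
  fderiv ℝ (fun y => fderiv ℝ f y w) x v

/-- Coordinate direction `α` in the first variable `x₁`. -/
def e1 (α : Fin 3) : E6 := (EuclideanSpace.single α (1 : ℝ), 0)

/-- Coordinate direction `α` in the second variable `x₂`. -/
def e2 (α : Fin 3) : E6 := (0, EuclideanSpace.single α (1 : ℝ))

/-- The quadratic form of `(∇₁·∇₂)² − Δ₁ − Δ₂ + 1`. -/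
def Qmix (ψ : E6 → ℂ) : ℝ :=
  ∫ x : E6,
    (‖∑ α : Fin 3, D2 ψ x (e1 α) (e2 α)‖ ^ 2
      + (∑ α : Fin 3, ‖fderiv ℝ ψ x (e1 α)‖ ^ 2)
      + (∑ α : Fin 3, ‖fderiv ℝ ψ x (e2 α)‖ ^ 2) + ‖ψ x‖ ^ 2)

/-- The quadratic form of `(∇₁−∇₂)⁴ + (∇₁+∇₂)² + 1`. -/
def Qrel (φ : E6 → ℂ) : ℝ :=
  ∫ x : E6,
    (‖∑ α : Fin 3, D2 φ x (e1 α - e2 α) (e1 α - e2 α)‖ ^ 2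
      + (∑ α : Fin 3, ‖fderiv ℝ φ x (e1 α + e2 α)‖ ^ 2) + ‖φ x‖ ^ 2)

/-! ### Kernel integrals -/

/-- The integrable majorant `√(1 + |t|) / (1 + t²)` used for all one-dimensional kernels. -/
def kernelMajorant (t : ℝ) : ℝ := Real.sqrt (1 + |t|) / (1 + t ^ 2)

lemma continuous_kernelMajorant : Continuous kernelMajorant := by
  unfold kernelMajorant
  exact Continuous.div (by fun_prop) (by fun_prop) fun t => by positivity

lemma kernelMajorant_nonneg (t : ℝ) : 0 ≤ kernelMajorant t := by
  unfold kernelMajorant; positivity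

lemma integrable_kernelMajorant : Integrable kernelMajorant := by
  have h := (integrable_one_add_norm (E := ℝ) (μ := volume) (r := 3 / 2)
    (by simp; norm_num)).const_mul 2
  refine h.mono' continuous_kernelMajorant.aestronglyMeasurable (ae_of_all _ fun t => ?_)
  rw [Real.norm_of_nonneg (kernelMajorant_nonneg t), Real.norm_eq_abs]
  unfold kernelMajorant
  have hp : 0 < 1 + |t| := by positivity
  have h1 : (1 + |t|) ^ (-(3 / 2) : ℝ) = Real.sqrt (1 + |t|) / (1 + |t|) ^ 2 := by
    rw [Real.sqrt_eq_rpow, ← Real.rpow_natCast (1 + |t|) 2, ← Real.rpow_sub hp]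
    norm_num
  rw [h1, div_le_iff₀ (by positivity), ← mul_div_assoc, div_mul_eq_mul_div,
    le_div_iff₀ (by positivity)]
  have h2 : (1 + |t|) ^ 2 ≤ 2 * (1 + t ^ 2) := by
    nlinarith [sq_nonneg (1 - |t|), sq_abs t]
  nlinarith [Real.sqrt_nonneg (1 + |t|)]

lemma inv_one_add_sq_le_kernelMajorant (t : ℝ) : 1 / (1 + t ^ 2) ≤ kernelMajorant t := by
  unfold kernelMajorant
  gcongr
  exact Real.one_le_sqrt.2 (by linarith [abs_nonneg t])

/-- The constant of the polar coordinate formula in dimension three. -/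
def sphereConst : ℝ := 3 * (volume : Measure E3).real (Metric.ball 0 1)

lemma sphereConst_nonneg : 0 ≤ sphereConst := by unfold sphereConst; positivity

lemma lintegral_radial_le {f h : ℝ → ℝ} (hf : Continuous f) (hf0 : ∀ r, 0 ≤ f r)
    (hh : Integrable h) (hh0 : ∀ r, 0 ≤ h r) (hle : ∀ r, 0 < r → r ^ 2 * f r ≤ h r) :
    ∫⁻ x : E3, ENNReal.ofReal (f ‖x‖) ≤ ENNReal.ofReal (sphereConst * ∫ r, h r) := by
  have hdim : Module.finrank ℝ E3 = 3 := by simp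
  have hon : IntegrableOn (fun y : ℝ => y ^ (3 - 1) • f y) (Set.Ioi 0) := by
    refine Integrable.mono' hh.integrableOn (by fun_prop) ?_
    filter_upwards [ae_restrict_mem measurableSet_Ioi] with r hr
    rw [Real.norm_of_nonneg (smul_nonneg (pow_nonneg (le_of_lt hr) _) (hf0 r))]
    simpa using hle r hr
  have hint : Integrable (fun x : E3 => f ‖x‖) := by
    rw [integrable_fun_norm_addHaar, hdim]
    exact hon
  rw [← ofReal_integral_eq_lintegral_ofReal hint (ae_of_all _ fun x => hf0 _),
    integral_fun_norm_addHaar, hdim]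
  apply ENNReal.ofReal_le_ofReal
  rw [nsmul_eq_mul, smul_eq_mul, ← mul_assoc]
  unfold sphereConst
  push_cast
  gcongr
  calc ∫ y in Set.Ioi (0 : ℝ), y ^ (3 - 1) • f y ≤ ∫ y in Set.Ioi (0 : ℝ), h y := by
        refine setIntegral_mono_on hon hh.integrableOn measurableSet_Ioi fun r hr => ?_
        simpa using hle r hr
    _ ≤ ∫ y, h y := setIntegral_le_integral hh (ae_of_all _ hh0)

/-- Symbol of the relative energy form. -/
def relSymbol (K r : ℝ) : ℝ := r ^ 4 + K ^ 2 + 1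

/-- Symbol of the mixed energy form. -/
def mixSymbol (K r : ℝ) : ℝ := (K ^ 2 / 4 - r ^ 2) ^ 2 + r ^ 2 + 1

lemma relSymbol_pos (K r : ℝ) : 0 < relSymbol K r := by unfold relSymbol; positivity

lemma mixSymbol_pos (K r : ℝ) : 0 < mixSymbol K r := by unfold mixSymbol; positivity

@[fun_prop]
lemma Continuous.relSymbol {X : Type*} [TopologicalSpace X] {f g : X → ℝ} (hf : Continuous f)
    (hg : Continuous g) : Continuous fun x => relSymbol (f x) (g x) := by
  unfold _root_.relSymbol; fun_prop

@[fun_prop]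
lemma Continuous.mixSymbol {X : Type*} [TopologicalSpace X] {f g : X → ℝ} (hf : Continuous f)
    (hg : Continuous g) : Continuous fun x => mixSymbol (f x) (g x) := by
  unfold _root_.mixSymbol; fun_prop

lemma le_relSymbol (K r : ℝ) : (r ^ 2 + (1 + K)) ^ 2 ≤ 3 * relSymbol K r := by
  unfold relSymbol
  nlinarith [sq_nonneg (r ^ 2 - K), sq_nonneg (r ^ 2 - 1), sq_nonneg (K - 1)]

lemma le_mixSymbol {K r : ℝ} (hK : 0 ≤ K) (hr : 0 ≤ r) :
    r ^ 2 * (1 + (r - K / 2) ^ 2) ≤ mixSymbol K r := by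
  unfold mixSymbol
  have h : r ^ 2 * (r - K / 2) ^ 2 ≤ (r + K / 2) ^ 2 * (r - K / 2) ^ 2 := by
    gcongr; linarith
  nlinarith

lemma integral_inv_sq_add {M : ℝ} (hM : 0 < M) :
    Integrable (fun r : ℝ => 1 / (r ^ 2 + M)) ∧
      ∫ r : ℝ, 1 / (r ^ 2 + M) = Real.pi / Real.sqrt M := by
  have hs : 0 < Real.sqrt M := Real.sqrt_pos.2 hM
  have heq : (fun r : ℝ => 1 / (r ^ 2 + M)) =
      fun r => M⁻¹ * (1 + (r / Real.sqrt M) ^ 2)⁻¹ := by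
    ext r
    rw [div_pow, Real.sq_sqrt hM.le]
    field_simp
    ring
  constructor
  · rw [heq]
    exact (integrable_inv_one_add_sq.comp_div hs.ne').const_mul _
  · rw [heq, integral_const_mul,
      Measure.integral_comp_div (fun x : ℝ => (1 + x ^ 2)⁻¹) (Real.sqrt M),
      integral_univ_inv_one_add_sq, abs_of_pos hs, smul_eq_mul]
    rw [eq_div_iff hs.ne']
    field_simp
    rw [Real.sq_sqrt hM.le]

/-- A bound for all weighted kernel integrals. -/
def kernelConst : ℝ :=
  max (sphereConst * (3 * Real.pi)) (sphereConst * (3 * ∫ t, kernelMajorant t))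

lemma kernelConst_nonneg : 0 ≤ kernelConst :=
  le_max_of_le_left (mul_nonneg sphereConst_nonneg (by positivity))

lemma lintegral_inv_relSymbol_le {K : ℝ} (hK : 0 ≤ K) :
    ∫⁻ x : E3, ENNReal.ofReal (1 / relSymbol K ‖x‖) ≤
      ENNReal.ofReal (kernelConst / Real.sqrt (1 + K)) := by
  have hM : 0 < 1 + K := by linarith
  obtain ⟨hi, he⟩ := integral_inv_sq_add hM
  refine (lintegral_radial_le (f := fun r => 1 / relSymbol K r)
    (h := fun r => 3 * (1 / (r ^ 2 + (1 + K))))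
    (Continuous.div (by fun_prop) (by fun_prop) fun r => (relSymbol_pos K r).ne')
    (fun r => (div_pos one_pos (relSymbol_pos K r)).le) (hi.const_mul 3)
    (fun r => by positivity) fun r hr => ?_).trans (ENNReal.ofReal_le_ofReal ?_)
  · have h := le_relSymbol K r
    rw [mul_one_div, mul_one_div, div_le_div_iff₀ (relSymbol_pos K r) (by positivity)]
    nlinarith
  · rw [integral_const_mul, he, ← mul_div_assoc, ← mul_div_assoc]
    gcongr
    exact le_max_left _ _

lemma lintegral_sqrt_div_relSymbol_le {K : ℝ} (hK : 0 ≤ K) :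
    ∫⁻ x : E3, ENNReal.ofReal (Real.sqrt (1 + ‖x‖) / relSymbol K ‖x‖) ≤
      ENNReal.ofReal kernelConst := by
  refine (lintegral_radial_le (f := fun r => Real.sqrt (1 + r) / relSymbol K r)
    (h := fun r => 3 * kernelMajorant r)
    (Continuous.div (by fun_prop) (by fun_prop) fun r => (relSymbol_pos K r).ne')
    (fun r => div_nonneg (by positivity) (relSymbol_pos K r).le)
    (integrable_kernelMajorant.const_mul 3)
    (fun r => mul_nonneg (by norm_num) (kernelMajorant_nonneg r)) fun r hr => ?_).trans
    (ENNReal.ofReal_le_ofReal ?_)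
  · have h := le_relSymbol K r
    have h2 : r ^ 2 * (1 + r ^ 2) ≤ 3 * relSymbol K r := by nlinarith
    unfold kernelMajorant
    rw [abs_of_pos hr, ← mul_div_assoc, ← mul_div_assoc,
      div_le_div_iff₀ (relSymbol_pos K r) (by positivity)]
    nlinarith [Real.sqrt_nonneg (1 + r)]
  · rw [integral_const_mul]
    exact le_max_right _ _

lemma lintegral_inv_mixSymbol_le {K : ℝ} (hK : 0 ≤ K) :
    ∫⁻ x : E3, ENNReal.ofReal (1 / mixSymbol K ‖x‖) ≤ ENNReal.ofReal kernelConst := by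
  refine (lintegral_radial_le (f := fun r => 1 / mixSymbol K r)
    (h := fun r => kernelMajorant (r - K / 2))
    (Continuous.div (by fun_prop) (by fun_prop) fun r => (mixSymbol_pos K r).ne')
    (fun r => (div_pos one_pos (mixSymbol_pos K r)).le)
    (integrable_kernelMajorant.comp_sub_right _)
    (fun r => kernelMajorant_nonneg _) fun r hr => ?_).trans (ENNReal.ofReal_le_ofReal ?_)
  · refine le_trans ?_ (inv_one_add_sq_le_kernelMajorant _)
    have h := le_mixSymbol hK hr.le
    rw [mul_one_div, div_le_div_iff₀ (mixSymbol_pos K r) (by positivity)]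
    linarith
  · rw [integral_sub_right_eq_self kernelMajorant]
    refine le_trans ?_ (le_max_right _ _)
    have h0 : 0 ≤ ∫ t, kernelMajorant t := integral_nonneg kernelMajorant_nonneg
    nlinarith [mul_nonneg sphereConst_nonneg h0]

lemma lintegral_sqrt_div_mixSymbol_le {K : ℝ} (hK : 0 ≤ K) :
    ∫⁻ x : E3, ENNReal.ofReal (Real.sqrt (1 + ‖x‖) / mixSymbol K ‖x‖) ≤
      ENNReal.ofReal (kernelConst * Real.sqrt (1 + K)) := by
  refine (lintegral_radial_le (f := fun r => Real.sqrt (1 + r) / mixSymbol K r)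
    (h := fun r => Real.sqrt (1 + K) * kernelMajorant (r - K / 2))
    (Continuous.div (by fun_prop) (by fun_prop) fun r => (mixSymbol_pos K r).ne')
    (fun r => div_nonneg (by positivity) (mixSymbol_pos K r).le)
    ((integrable_kernelMajorant.comp_sub_right _).const_mul _)
    (fun r => mul_nonneg (by positivity) (kernelMajorant_nonneg _)) fun r hr => ?_).trans
    (ENNReal.ofReal_le_ofReal ?_)
  · have h := le_mixSymbol hK hr.le
    have hs : Real.sqrt (1 + r) ≤ Real.sqrt (1 + K) * Real.sqrt (1 + |r - K / 2|) := by
      rw [← Real.sqrt_mul (by linarith)]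
      apply Real.sqrt_le_sqrt
      nlinarith [le_abs_self (r - K / 2), mul_nonneg hK (abs_nonneg (r - K / 2))]
    unfold kernelMajorant
    rw [← mul_div_assoc, ← mul_div_assoc, div_le_div_iff₀ (mixSymbol_pos K r) (by positivity)]
    calc r ^ 2 * Real.sqrt (1 + r) * (1 + (r - K / 2) ^ 2)
        = Real.sqrt (1 + r) * (r ^ 2 * (1 + (r - K / 2) ^ 2)) := by ring
      _ ≤ _ := by gcongr
  · rw [integral_const_mul, integral_sub_right_eq_self kernelMajorant]
    have h0 : 0 ≤ ∫ t, kernelMajorant t := integral_nonneg kernelMajorant_nonneg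
    have h1 : sphereConst * ∫ t, kernelMajorant t ≤ kernelConst := by
      refine le_trans ?_ (le_max_right _ _)
      nlinarith [mul_nonneg sphereConst_nonneg h0]
    calc _ = (sphereConst * ∫ t, kernelMajorant t) * Real.sqrt (1 + K) := by ring
      _ ≤ _ := by gcongr

/-! ### Fourier representation of traces on slices -/

/-- `ℝ³ × ℝ³` with its Euclidean inner product. -/
abbrev H6 := WithLp 2 (E3 × E3)

lemma volume_preserving_toLp_E6 :
    MeasurePreserving (WithLp.toLp 2 : E6 → H6) volume volume :=
  WithLp.volume_preserving_toLp E3 E3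

lemma measurableEmbedding_toLp_E6 : MeasurableEmbedding (WithLp.toLp 2 : E6 → H6) :=
  (MeasurableEquiv.toLp 2 E6).measurableEmbedding

lemma continuous_toLp_E6 : Continuous (WithLp.toLp 2 : E6 → H6) :=
  WithLp.prod_continuous_toLp 2 E3 E3

lemma norm_fst_le_norm_toLp (x y : E3) : ‖x‖ ≤ ‖(WithLp.toLp 2 (x, y) : H6)‖ := by
  rw [WithLp.prod_norm_eq_of_L2]
  exact Real.le_sqrt_of_sq_le (by simp)

lemma norm_snd_le_norm_toLp (x y : E3) : ‖y‖ ≤ ‖(WithLp.toLp 2 (x, y) : H6)‖ := by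
  rw [WithLp.prod_norm_eq_of_L2]
  exact Real.le_sqrt_of_sq_le (by simp)

lemma integrable_decay : Integrable fun x : E3 => (1 + ‖x‖) ^ (-4 : ℝ) :=
  integrable_one_add_norm (by simp; norm_num)

lemma SchwartzMap.exists_decay (f : SchwartzMap H6 ℂ) :
    ∃ C : ℝ, 0 ≤ C ∧ ∀ x, ‖f x‖ ≤ C * (1 + ‖x‖) ^ (-4 : ℝ) := by
  have h (x : H6) :=
    SchwartzMap.one_add_le_sup_seminorm_apply (𝕜 := ℝ) (m := (4, 0)) le_rfl le_rfl f x
  refine ⟨2 ^ 4 * (Finset.Iic (4, 0)).sup (fun m => SchwartzMap.seminorm ℝ m.1 m.2) f,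
    by positivity, fun x => ?_⟩
  have hx := h x
  rw [norm_iteratedFDeriv_zero] at hx
  rw [Real.rpow_neg (by positivity), ← div_eq_mul_inv, le_div_iff₀ (by positivity), mul_comm]
  exact_mod_cast hx

lemma SchwartzMap.exists_decay_snd (f : SchwartzMap H6 ℂ) :
    ∃ C : ℝ, 0 ≤ C ∧ ∀ x y, ‖f (WithLp.toLp 2 (x, y))‖ ≤ C * (1 + ‖y‖) ^ (-4 : ℝ) := by
  obtain ⟨C, hC, h⟩ := f.exists_decay
  refine ⟨C, hC, fun x y => (h _).trans ?_⟩
  gcongr C * ?_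
  exact Real.rpow_le_rpow_of_nonpos (by positivity)
    (by linarith [norm_snd_le_norm_toLp x y]) (by norm_num)

lemma SchwartzMap.exists_decay_fst (f : SchwartzMap H6 ℂ) :
    ∃ C : ℝ, 0 ≤ C ∧ ∀ x y, ‖f (WithLp.toLp 2 (x, y))‖ ≤ C * (1 + ‖x‖) ^ (-4 : ℝ) := by
  obtain ⟨C, hC, h⟩ := f.exists_decay
  refine ⟨C, hC, fun x y => (h _).trans ?_⟩
  gcongr C * ?_
  exact Real.rpow_le_rpow_of_nonpos (by positivity)
    (by linarith [norm_fst_le_norm_toLp x y]) (by norm_num)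

/-- The embedding `u ↦ (u, w)`. -/
def sliceMap (w : E3) (u : E3) : H6 := WithLp.toLp 2 (u, w)

lemma sliceMap_hasTemperateGrowth (w : E3) : (sliceMap w).HasTemperateGrowth := by
  have h : sliceMap w = fun u =>
      ((WithLp.prodContinuousLinearEquiv 2 ℝ E3 E3).symm.toContinuousLinearMap.comp
        (ContinuousLinearMap.inl ℝ E3 E3)) u + WithLp.toLp 2 ((0 : E3), w) := by
    ext1 u
    change WithLp.toLp 2 (u, w) = WithLp.toLp 2 (u, (0 : E3)) + WithLp.toLp 2 ((0 : E3), w)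
    rw [← WithLp.toLp_add]
    simp
  rw [h]
  fun_prop

lemma sliceMap_antilipschitz (w : E3) : AntilipschitzWith 1 (sliceMap w) := by
  refine AntilipschitzWith.of_le_mul_dist fun x y => ?_
  rw [dist_eq_norm, dist_eq_norm, NNReal.coe_one, one_mul]
  have h : sliceMap w x - sliceMap w y = WithLp.toLp 2 (x - y, (0 : E3)) := by
    rw [sliceMap, sliceMap, ← WithLp.toLp_sub]
    simp
  rw [h]
  exact norm_fst_le_norm_toLp _ _

/-- The restriction of a Schwartz function to the slice `{(u, w) | u ∈ ℝ³}`. -/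
def slice (f : SchwartzMap H6 ℂ) (w : E3) : SchwartzMap E3 ℂ :=
  SchwartzMap.compCLMOfAntilipschitz ℝ (sliceMap_hasTemperateGrowth w)
    (sliceMap_antilipschitz w) f

lemma slice_apply (f : SchwartzMap H6 ℂ) (w u : E3) : slice f w u = f (WithLp.toLp 2 (u, w)) :=
  rfl

open FourierTransform RealInnerProductSpace

/-- Inverse Fourier transform in the second variable. -/
def partialFourierInv (F : SchwartzMap H6 ℂ) (w K : E3) : ℂ :=
  ∫ k : E3, Real.fourierChar ⟪k, w⟫ • F (WithLp.toLp 2 (K, k))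

lemma integrable_partialFourierInv_integrand (F : SchwartzMap H6 ℂ) (w K : E3) :
    Integrable fun k : E3 => Real.fourierChar ⟪k, w⟫ • F (WithLp.toLp 2 (K, k)) := by
  obtain ⟨C, -, hC⟩ := F.exists_decay_snd
  refine (integrable_decay.const_mul C).mono' (Continuous.aestronglyMeasurable ?_)
    (ae_of_all _ fun k => ?_)
  · have := F.continuous.comp (continuous_toLp_E6.comp (Continuous.prodMk_right K))
    have h2 : Continuous fun k : E3 => Real.fourierChar ⟪k, w⟫ :=
      Real.continuous_fourierChar.comp (by fun_prop)
    exact h2.smul this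
  · rw [Circle.norm_smul]
    exact hC K k

lemma continuous_partialFourierInv (F : SchwartzMap H6 ℂ) (w : E3) :
    Continuous (partialFourierInv F w) := by
  obtain ⟨C, -, hC⟩ := F.exists_decay_snd
  refine continuous_of_dominated (bound := fun k => C * (1 + ‖k‖) ^ (-4 : ℝ))
    (fun K => (integrable_partialFourierInv_integrand F w K).aestronglyMeasurable)
    (fun K => ae_of_all _ fun k => ?_) (integrable_decay.const_mul C) (ae_of_all _ fun k => ?_)
  · rw [Circle.norm_smul]
    exact hC K k
  · exact (F.continuous.comp (continuous_toLp_E6.comp (Continuous.prodMk_left k))).const_smul _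

lemma integrable_phase_smul (F : SchwartzMap H6 ℂ) (u w : E3) :
    Integrable (fun p : E6 => Real.fourierChar ⟪p.1, u⟫ • Real.fourierChar ⟪p.2, w⟫ •
      F (WithLp.toLp 2 p)) (volume.prod volume) := by
  have h : Integrable (fun p : E6 => F (WithLp.toLp 2 p)) (volume.prod volume) :=
    (volume_preserving_toLp_E6.integrable_comp_emb measurableEmbedding_toLp_E6).2 F.integrable
  have h1 : Continuous fun p : E6 => Real.fourierChar ⟪p.1, u⟫ :=
    Real.continuous_fourierChar.comp (by fun_prop)
  have h2 : Continuous fun p : E6 => Real.fourierChar ⟪p.2, w⟫ :=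
    Real.continuous_fourierChar.comp (by fun_prop)
  refine h.mono (h1.smul (h2.smul (F.continuous.comp continuous_toLp_E6))).aestronglyMeasurable
    (ae_of_all _ fun p => ?_)
  rw [Circle.norm_smul, Circle.norm_smul]

lemma integrable_partialFourierInv (F : SchwartzMap H6 ℂ) (w : E3) :
    Integrable (partialFourierInv F w) := by
  have h := (integrable_phase_smul F 0 w).integral_prod_left
  simp only [inner_zero_right, AddChar.map_zero_eq_one, one_smul] at h
  exact h

lemma fourierInv_partialFourierInv (f : SchwartzMap H6 ℂ) (w u : E3) :
    𝓕⁻ (partialFourierInv (𝓕 f) w) u = f (WithLp.toLp 2 (u, w)) := by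
  have h1 : f (WithLp.toLp 2 (u, w)) = 𝓕⁻ (𝓕 f) (WithLp.toLp 2 (u, w)) := by simp
  rw [h1, SchwartzMap.fourierInv_coe, Real.fourierInv_eq, Real.fourierInv_eq,
    ← volume_preserving_toLp_E6.integral_comp measurableEmbedding_toLp_E6]
  have h2 := integral_prod _ (integrable_phase_smul (𝓕 f) u w)
  have h3 : ∀ p : E6, Real.fourierChar ⟪(WithLp.toLp 2 p : H6), WithLp.toLp 2 (u, w)⟫ •
      (𝓕 f) (WithLp.toLp 2 p) = Real.fourierChar ⟪p.1, u⟫ • Real.fourierChar ⟪p.2, w⟫ •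
      (𝓕 f) (WithLp.toLp 2 p) := fun p => by
    rw [WithLp.prod_inner_apply, AddChar.map_add_eq_mul, mul_smul]
  simp_rw [h3]
  refine Eq.trans ?_ h2.symm
  refine integral_congr_ae (ae_of_all _ fun K => ?_)
  simp only [partialFourierInv]
  simp_rw [Circle.smul_def, smul_eq_mul]
  exact (integral_const_mul _ _).symm

lemma fourier_slice (f : SchwartzMap H6 ℂ) (w K : E3) :
    𝓕 (slice f w) K = partialFourierInv (𝓕 f) w K := by
  have h : 𝓕⁻ (partialFourierInv (𝓕 f) w) = slice f w := by
    ext u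
    rw [fourierInv_partialFourierInv, slice_apply]
  have h2 : Integrable (𝓕 (partialFourierInv (𝓕 f) w)) := by
    have h3 : 𝓕 (partialFourierInv (𝓕 f) w) = fun u => slice f w (-u) := by
      ext u
      rw [← h, Real.fourierInv_eq_fourier_neg, neg_neg]
    rw [h3]
    exact (slice f w).integrable.comp_neg
  have h4 := (continuous_partialFourierInv (𝓕 f) w).fourier_fourierInv_eq
    (integrable_partialFourierInv (𝓕 f) w) h2
  rw [← h4, h, SchwartzMap.fourier_coe]

/-- The pairing of two functions on the slice of relative coordinate `w`. -/
def slicePairing (f g : SchwartzMap H6 ℂ) (w : E3) : ℂ :=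
  ∫ u : E3, conj (f (WithLp.toLp 2 (u, w))) * g (WithLp.toLp 2 (u, w))

lemma slicePairing_eq (f g : SchwartzMap H6 ℂ) (w : E3) :
    slicePairing f g w =
      ∫ K, conj (partialFourierInv (𝓕 f) w K) * partialFourierInv (𝓕 g) w K := by
  have h := SchwartzMap.integral_inner_fourier_fourier (slice f w) (slice g w)
  simp only [RCLike.inner_apply', fourier_slice, slice_apply] at h
  exact h.symm

lemma integrable_conj_mul (f g : SchwartzMap E3 ℂ) : Integrable fun x => conj (f x) * g x := by
  have h : Integrable fun x => g x * conj (f x) := by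
    refine g.integrable.mul_bdd (c := SchwartzMap.seminorm ℝ 0 0 f)
      (Complex.continuous_conj.comp f.continuous).aestronglyMeasurable (ae_of_all _ fun x => ?_)
    simpa using SchwartzMap.norm_le_seminorm ℝ f x
  simpa only [mul_comm] using h

lemma integrable_partialFourierInv_mul (f g : SchwartzMap H6 ℂ) (w : E3) :
    Integrable fun K =>
      conj (partialFourierInv (𝓕 f) w K) * partialFourierInv (𝓕 g) w K := by
  simpa only [fourier_slice] using integrable_conj_mul (𝓕 (slice f w)) (𝓕 (slice g w))

/-! ### Hölder continuity of the slice pairing -/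

lemma sq_lintegral_mul_le {X : Type*} [MeasurableSpace X] {μ : Measure X} {f g : X → ENNReal}
    (hf : AEMeasurable f μ) (hg : AEMeasurable g μ) :
    (∫⁻ x, f x * g x ∂μ) ^ 2 ≤ (∫⁻ x, f x ^ 2 ∂μ) * ∫⁻ x, g x ^ 2 ∂μ := by
  have h := ENNReal.lintegral_mul_le_Lp_mul_Lq μ Real.HolderConjugate.two_two hf hg
  simp only [Pi.mul_apply, ENNReal.rpow_ofNat] at h
  calc (∫⁻ x, f x * g x ∂μ) ^ 2
      ≤ ((∫⁻ x, f x ^ 2 ∂μ) ^ (1 / 2 : ℝ) * (∫⁻ x, g x ^ 2 ∂μ) ^ (1 / 2 : ℝ)) ^ 2 := by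
        gcongr
    _ = _ := by
        rw [mul_pow, ← ENNReal.rpow_natCast, ← ENNReal.rpow_natCast, ← ENNReal.rpow_mul,
          ← ENNReal.rpow_mul]
        norm_num

/-- The energy of a Schwartz function `F` on phase space at fixed total momentum `K`. -/
def energyDensity (A : ℝ → ℝ → ℝ) (F : SchwartzMap H6 ℂ) (K : E3) : ENNReal :=
  ∫⁻ k : E3, ENNReal.ofReal (A ‖K‖ ‖k‖) * ‖F (WithLp.toLp 2 (K, k))‖ₑ ^ 2

lemma measurable_energyDensity {A : ℝ → ℝ → ℝ} (hA : Continuous fun p : ℝ × ℝ => A p.1 p.2)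
    (F : SchwartzMap H6 ℂ) : Measurable (energyDensity A F) := by
  have h1 : Measurable fun p : E3 × E3 => ENNReal.ofReal (A ‖p.1‖ ‖p.2‖) :=
    (hA.comp (f := fun p : E3 × E3 => (‖p.1‖, ‖p.2‖)) (by fun_prop)).measurable.ennreal_ofReal
  have h2 : Measurable fun p : E3 × E3 => ‖F (WithLp.toLp 2 p)‖ₑ ^ 2 :=
    (F.continuous.comp continuous_toLp_E6).enorm.measurable.pow_const 2
  exact (h1.mul h2).lintegral_prod_right'

lemma enorm_integral_mul_sq_le {A : ℝ → ℝ → ℝ} (hA : Continuous fun p : ℝ × ℝ => A p.1 p.2)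
    (hA0 : ∀ K r, 0 < A K r) (F : SchwartzMap H6 ℂ) {θ : E3 → ℂ} (hθ : Continuous θ)
    (K : E3) :
    ‖∫ k : E3, θ k * F (WithLp.toLp 2 (K, k))‖ₑ ^ 2 ≤
      (∫⁻ k : E3, ENNReal.ofReal (‖θ k‖ ^ 2 / A ‖K‖ ‖k‖)) * energyDensity A F K := by
  have hAK : Continuous fun k : E3 => A ‖K‖ ‖k‖ :=
    hA.comp (f := fun k : E3 => (‖K‖, ‖k‖)) (by fun_prop)
  have hsq : Continuous fun k : E3 => Real.sqrt (A ‖K‖ ‖k‖) := hAK.sqrt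
  have hFK : Continuous fun k : E3 => F (WithLp.toLp 2 (K, k)) :=
    F.continuous.comp (continuous_toLp_E6.comp (Continuous.prodMk_right K))
  have hpt : ∀ k : E3, ‖θ k * F (WithLp.toLp 2 (K, k))‖ₑ =
      ENNReal.ofReal (‖θ k‖ / Real.sqrt (A ‖K‖ ‖k‖)) *
        (ENNReal.ofReal (Real.sqrt (A ‖K‖ ‖k‖)) * ‖F (WithLp.toLp 2 (K, k))‖ₑ) := fun k => by
    rw [← mul_assoc, ← ENNReal.ofReal_mul (by positivity),
      div_mul_cancel₀ _ (Real.sqrt_pos.2 (hA0 _ _)).ne', enorm_mul, ofReal_norm]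
  have hm1 : Measurable fun k : E3 => ENNReal.ofReal (‖θ k‖ / Real.sqrt (A ‖K‖ ‖k‖)) :=
    (hθ.norm.measurable.div hsq.measurable).ennreal_ofReal
  have hm2 : Measurable fun k : E3 =>
      ENNReal.ofReal (Real.sqrt (A ‖K‖ ‖k‖)) * ‖F (WithLp.toLp 2 (K, k))‖ₑ :=
    hsq.measurable.ennreal_ofReal.mul hFK.enorm.measurable
  calc ‖∫ k : E3, θ k * F (WithLp.toLp 2 (K, k))‖ₑ ^ 2
      ≤ (∫⁻ k : E3, ‖θ k * F (WithLp.toLp 2 (K, k))‖ₑ) ^ 2 := by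
        gcongr; exact enorm_integral_le_lintegral_enorm _
    _ ≤ _ := by
        simp_rw [hpt]
        refine (sq_lintegral_mul_le hm1.aemeasurable hm2.aemeasurable).trans_eq ?_
        unfold energyDensity
        congr 1
        · refine lintegral_congr fun k => ?_
          rw [← ENNReal.ofReal_pow (by positivity), div_pow, Real.sq_sqrt (hA0 _ _).le]
        · refine lintegral_congr fun k => ?_
          rw [mul_pow, ← ENNReal.ofReal_pow (by positivity), Real.sq_sqrt (hA0 _ _).le]

/-- The modulus governing phase differences. -/
def phaseModulus (w : E3) : ℝ := min 1 (Real.sqrt ‖w‖)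

lemma phaseModulus_nonneg (w : E3) : 0 ≤ phaseModulus w :=
  le_min zero_le_one (Real.sqrt_nonneg _)

lemma norm_phase_sub_one_sq_le (k w : E3) :
    ‖(Real.fourierChar ⟪k, w⟫ : ℂ) - 1‖ ^ 2 ≤
      12 * phaseModulus w * Real.sqrt (1 + ‖k‖) := by
  set n := ‖(Real.fourierChar ⟪k, w⟫ : ℂ) - 1‖ with hn
  have hn0 : 0 ≤ n := norm_nonneg _
  have h2 : n ≤ 2 := by
    refine (norm_sub_le _ _).trans ?_
    rw [Circle.norm_coe, norm_one]
    norm_num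
  have h3 : n ≤ 2 * Real.pi * (‖k‖ * ‖w‖) := by
    have h := Real.norm_exp_I_mul_ofReal_sub_one_le (x := 2 * Real.pi * ⟪k, w⟫)
    rw [mul_comm, ← Real.fourierChar_apply] at h
    refine h.trans ?_
    rw [norm_mul, Real.norm_of_nonneg (by positivity)]
    gcongr
    exact abs_real_inner_le_norm k w
  have h4 : n ^ 2 ≤ 12 * (Real.sqrt ‖w‖ * Real.sqrt (1 + ‖k‖)) := by
    rw [← Real.sqrt_mul (norm_nonneg _)]
    refine abs_le_of_sq_le_sq' ?_ (by positivity) |>.2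
    rw [mul_pow, Real.sq_sqrt (by positivity)]
    have h5 : n ^ 3 ≤ 8 := by
      calc n ^ 3 ≤ 2 ^ 3 := by gcongr
        _ = 8 := by norm_num
    calc (n ^ 2) ^ 2 = n ^ 3 * n := by ring
      _ ≤ 8 * (2 * Real.pi * (‖k‖ * ‖w‖)) := by gcongr
      _ ≤ 8 * (2 * 4 * (‖k‖ * ‖w‖)) := by gcongr; exact Real.pi_le_four
      _ ≤ 12 ^ 2 * (‖w‖ * (1 + ‖k‖)) := by
        nlinarith [mul_nonneg (norm_nonneg k) (norm_nonneg w), norm_nonneg w]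
  have h6 : 1 ≤ Real.sqrt (1 + ‖k‖) := Real.one_le_sqrt.2 (by linarith [norm_nonneg k])
  rw [mul_assoc]
  unfold phaseModulus
  rcases min_choice 1 (Real.sqrt ‖w‖) with h | h <;> rw [h]
  · nlinarith
  · exact h4

lemma partialFourierInv_eq (F : SchwartzMap H6 ℂ) (w K : E3) :
    partialFourierInv F w K =
      ∫ k : E3, (Real.fourierChar ⟪k, w⟫ : ℂ) * F (WithLp.toLp 2 (K, k)) := rfl

lemma partialFourierInv_sub_eq (F : SchwartzMap H6 ℂ) (w K : E3) :
    partialFourierInv F w K - partialFourierInv F 0 K =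
      ∫ k : E3, ((Real.fourierChar ⟪k, w⟫ : ℂ) - 1) * F (WithLp.toLp 2 (K, k)) := by
  unfold partialFourierInv
  rw [← integral_sub (integrable_partialFourierInv_integrand F w K)
    (integrable_partialFourierInv_integrand F 0 K)]
  refine integral_congr_ae (ae_of_all _ fun k => ?_)
  simp [Circle.smul_def, sub_mul]

lemma continuous_phase (w : E3) : Continuous fun k : E3 => (Real.fourierChar ⟪k, w⟫ : ℂ) :=
  continuous_subtype_val.comp (Real.continuous_fourierChar.comp (by fun_prop))

lemma enorm_partialFourierInv_sq_le {A : ℝ → ℝ → ℝ}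
    (hA : Continuous fun p : ℝ × ℝ => A p.1 p.2) (hA0 : ∀ K r, 0 < A K r)
    (F : SchwartzMap H6 ℂ) (w K : E3) {c : ℝ}
    (hc : ∫⁻ k : E3, ENNReal.ofReal (1 / A ‖K‖ ‖k‖) ≤ ENNReal.ofReal c) :
    ‖partialFourierInv F w K‖ₑ ^ 2 ≤ ENNReal.ofReal c * energyDensity A F K := by
  rw [partialFourierInv_eq]
  refine (enorm_integral_mul_sq_le hA hA0 F (continuous_phase w) K).trans ?_
  gcongr
  simpa only [Circle.norm_coe, one_pow] using hc

lemma enorm_partialFourierInv_sub_sq_le {A : ℝ → ℝ → ℝ}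
    (hA : Continuous fun p : ℝ × ℝ => A p.1 p.2) (hA0 : ∀ K r, 0 < A K r)
    (F : SchwartzMap H6 ℂ) (w K : E3) {c : ℝ}
    (hc : ∫⁻ k : E3, ENNReal.ofReal (Real.sqrt (1 + ‖k‖) / A ‖K‖ ‖k‖) ≤ ENNReal.ofReal c) :
    ‖partialFourierInv F w K - partialFourierInv F 0 K‖ₑ ^ 2 ≤
      ENNReal.ofReal (12 * phaseModulus w * c) * energyDensity A F K := by
  have hm : 0 ≤ 12 * phaseModulus w := mul_nonneg (by norm_num) (phaseModulus_nonneg w)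
  rw [partialFourierInv_sub_eq]
  refine (enorm_integral_mul_sq_le hA hA0 F
    ((continuous_phase w).sub continuous_const) K).trans ?_
  gcongr
  rw [ENNReal.ofReal_mul hm]
  refine le_trans ?_ (mul_le_mul_right hc _)
  rw [← lintegral_const_mul' _ _ ENNReal.ofReal_ne_top]
  refine lintegral_mono fun k => ?_
  rw [← ENNReal.ofReal_mul hm]
  apply ENNReal.ofReal_le_ofReal
  rw [← mul_div_assoc]
  gcongr
  · exact (hA0 _ _).le
  · exact norm_phase_sub_one_sq_le k w

lemma ENNReal.mul_le_of_sq_le {x y c d e a b : ENNReal} (hx : x ^ 2 ≤ c * a) (hy : y ^ 2 ≤ d * b)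
    (he : c * d ≤ e) : x * y ≤ e ^ (1 / 2 : ℝ) * (a ^ (1 / 2 : ℝ) * b ^ (1 / 2 : ℝ)) := by
  have h : (x * y) ^ (2 : ℝ) ≤ e * (a * b) := by
    rw [ENNReal.rpow_ofNat, mul_pow]
    calc x ^ 2 * y ^ 2 ≤ (c * a) * (d * b) := by gcongr
      _ = (c * d) * (a * b) := by ring
      _ ≤ _ := by gcongr
  rw [← ENNReal.mul_rpow_of_nonneg _ _ (by norm_num), ← ENNReal.mul_rpow_of_nonneg _ _ (by norm_num)]
  rwa [one_div, ENNReal.le_rpow_inv_iff (by norm_num)]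

/-- The constant in the Hölder bound for the slice pairing. -/
def holderConst : ℝ := 12 * kernelConst ^ 2

lemma continuous_relSymbol : Continuous fun p : ℝ × ℝ => relSymbol p.1 p.2 := by fun_prop

lemma continuous_mixSymbol : Continuous fun p : ℝ × ℝ => mixSymbol p.1 p.2 := by fun_prop

lemma enorm_partialFourierInv_mul_sub_le (F G : SchwartzMap H6 ℂ) (w K : E3) :
    ‖conj (partialFourierInv F w K) * partialFourierInv G w K -
        conj (partialFourierInv F 0 K) * partialFourierInv G 0 K‖ₑ ≤
      2 * (ENNReal.ofReal (holderConst * phaseModulus w) ^ (1 / 2 : ℝ) *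
        (energyDensity relSymbol F K ^ (1 / 2 : ℝ) *
          energyDensity mixSymbol G K ^ (1 / 2 : ℝ))) := by
  have hm := phaseModulus_nonneg w
  have hk := kernelConst_nonneg
  have hs : 0 < Real.sqrt (1 + ‖K‖) := Real.sqrt_pos.2 (by positivity)
  have hsplit : conj (partialFourierInv F w K) * partialFourierInv G w K -
        conj (partialFourierInv F 0 K) * partialFourierInv G 0 K =
      conj (partialFourierInv F w K - partialFourierInv F 0 K) * partialFourierInv G w K +
        conj (partialFourierInv F 0 K) *
          (partialFourierInv G w K - partialFourierInv G 0 K) := by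
    rw [map_sub]; ring
  rw [hsplit]
  refine (enorm_add_le _ _).trans ?_
  rw [enorm_mul, enorm_mul, RCLike.enorm_conj, RCLike.enorm_conj, two_mul]
  refine add_le_add (ENNReal.mul_le_of_sq_le
    (enorm_partialFourierInv_sub_sq_le continuous_relSymbol relSymbol_pos F w K
      (lintegral_sqrt_div_relSymbol_le (norm_nonneg K)))
    (enorm_partialFourierInv_sq_le continuous_mixSymbol mixSymbol_pos G w K
      (lintegral_inv_mixSymbol_le (norm_nonneg K))) ?_)
    (ENNReal.mul_le_of_sq_le
    (enorm_partialFourierInv_sq_le continuous_relSymbol relSymbol_pos F 0 K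
      (lintegral_inv_relSymbol_le (norm_nonneg K)))
    (enorm_partialFourierInv_sub_sq_le continuous_mixSymbol mixSymbol_pos G w K
      (lintegral_sqrt_div_mixSymbol_le (norm_nonneg K))) ?_)
  · rw [← ENNReal.ofReal_mul (by positivity)]
    apply ENNReal.ofReal_le_ofReal
    unfold holderConst
    apply le_of_eq
    ring
  · rw [← ENNReal.ofReal_mul (by positivity)]
    apply ENNReal.ofReal_le_ofReal
    unfold holderConst
    apply le_of_eq
    field_simp

lemma norm_slicePairing_sub_le (f g : SchwartzMap H6 ℂ) {QA QB : ℝ}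
    (hf : ∫⁻ K, energyDensity relSymbol (𝓕 f) K ≤ ENNReal.ofReal QA)
    (hg : ∫⁻ K, energyDensity mixSymbol (𝓕 g) K ≤ ENNReal.ofReal QB) (w : E3) :
    ‖slicePairing f g w - slicePairing f g 0‖ ≤
      2 * Real.sqrt holderConst * Real.sqrt (phaseModulus w) * Real.sqrt QB * Real.sqrt QA := by
  have hm := phaseModulus_nonneg w
  have hc : 0 ≤ holderConst := by unfold holderConst; positivity
  have hma := measurable_energyDensity continuous_relSymbol (𝓕 f)
  have hmb := measurable_energyDensity continuous_mixSymbol (𝓕 g)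
  have hcs : ∫⁻ K, energyDensity relSymbol (𝓕 f) K ^ (1 / 2 : ℝ) *
      energyDensity mixSymbol (𝓕 g) K ^ (1 / 2 : ℝ) ≤
      ENNReal.ofReal (Real.sqrt QA) * ENNReal.ofReal (Real.sqrt QB) := by
    have hof (Q : ℝ) : ENNReal.ofReal Q ^ (1 / 2 : ℝ) = ENNReal.ofReal (Real.sqrt Q) := by
      rcases le_total 0 Q with h | h
      · rw [Real.sqrt_eq_rpow, ENNReal.ofReal_rpow_of_nonneg h (by norm_num)]
      · rw [Real.sqrt_eq_zero_of_nonpos h, ENNReal.ofReal_of_nonpos h]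
        simp
    have hsq (x : ENNReal) : (x ^ (1 / 2 : ℝ)) ^ (2 : ℝ) = x := by
      rw [← ENNReal.rpow_mul]; norm_num
    have h := ENNReal.lintegral_mul_le_Lp_mul_Lq volume Real.HolderConjugate.two_two
      (hma.pow_const (1 / 2 : ℝ)).aemeasurable (hmb.pow_const (1 / 2 : ℝ)).aemeasurable
    simp only [Pi.mul_apply, hsq] at h
    refine h.trans ?_
    rw [← hof, ← hof]
    gcongr
  rw [slicePairing_eq, slicePairing_eq, ← integral_sub (integrable_partialFourierInv_mul f g w)
    (integrable_partialFourierInv_mul f g 0)]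
  have hfin : ‖∫ K, (conj (partialFourierInv (𝓕 f) w K) * partialFourierInv (𝓕 g) w K -
        conj (partialFourierInv (𝓕 f) 0 K) * partialFourierInv (𝓕 g) 0 K)‖ₑ ≤
      ENNReal.ofReal (2 * Real.sqrt holderConst * Real.sqrt (phaseModulus w) *
        Real.sqrt QB * Real.sqrt QA) := by
    refine (enorm_integral_le_lintegral_enorm _).trans
      ((lintegral_mono fun K => enorm_partialFourierInv_mul_sub_le (𝓕 f) (𝓕 g) w K).trans ?_)
    rw [lintegral_const_mul' _ _ (by simp), lintegral_const_mul' _ _ (by simp)]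
    refine (mul_le_mul_right (mul_le_mul_right hcs _) _).trans_eq ?_
    rw [ENNReal.ofReal_rpow_of_nonneg (by positivity) (by norm_num), ← Real.sqrt_eq_rpow,
      Real.sqrt_mul hc, ← ENNReal.ofReal_mul (by positivity), ← ENNReal.ofReal_mul (by positivity),
      ← ENNReal.ofReal_ofNat, ← ENNReal.ofReal_mul (by positivity)]
    congr 1
    ring
  rw [← ofReal_norm] at hfin
  exact (ENNReal.ofReal_le_ofReal_iff (by positivity)).1 hfin


/-! ### Centre-of-mass coordinates -/

/-- The map `(u, r) ↦ (u + r / 2, u - r / 2)`. -/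
def fromRelative : H6 →L[ℝ] E6 :=
  ((ContinuousLinearMap.fst ℝ E3 E3 + (1 / 2 : ℝ) • ContinuousLinearMap.snd ℝ E3 E3).prod
    (ContinuousLinearMap.fst ℝ E3 E3 - (1 / 2 : ℝ) • ContinuousLinearMap.snd ℝ E3 E3)).comp
    (WithLp.prodContinuousLinearEquiv 2 ℝ E3 E3).toContinuousLinearMap

/-- The map `(x₁, x₂) ↦ ((x₁ + x₂) / 2, x₁ - x₂)`. -/
def toRelative : E6 →L[ℝ] H6 :=
  (WithLp.prodContinuousLinearEquiv 2 ℝ E3 E3).symm.toContinuousLinearMap.comp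
    (((1 / 2 : ℝ) • (ContinuousLinearMap.fst ℝ E3 E3 + ContinuousLinearMap.snd ℝ E3 E3)).prod
      (ContinuousLinearMap.fst ℝ E3 E3 - ContinuousLinearMap.snd ℝ E3 E3))

lemma fromRelative_toLp (u r : E3) :
    fromRelative (WithLp.toLp 2 (u, r)) = (u + (1 / 2 : ℝ) • r, u - (1 / 2 : ℝ) • r) := rfl

lemma toRelative_apply (x : E6) :
    toRelative x = WithLp.toLp 2 ((1 / 2 : ℝ) • (x.1 + x.2), x.1 - x.2) := rfl

/-- The change of variables from centre-of-mass and relative coordinates to positions. -/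
def relativeEquiv : H6 ≃L[ℝ] E6 :=
  ContinuousLinearEquiv.equivOfInverse fromRelative toRelative
    (fun x => by
      obtain ⟨⟨u, r⟩⟩ := x
      rw [fromRelative_toLp, toRelative_apply]
      congr 2 <;> module)
    (fun x => by
      obtain ⟨x, y⟩ := x
      rw [toRelative_apply, fromRelative_toLp]
      congr 1 <;> module)

lemma relativeEquiv_toLp (u r : E3) :
    relativeEquiv (WithLp.toLp 2 (u, r)) = (u + (1 / 2 : ℝ) • r, u - (1 / 2 : ℝ) • r) := rfl

lemma measurePreserving_shear :
    MeasurePreserving (fun p : E6 => (p.1 + (1 / 2 : ℝ) • p.2, p.1 - (1 / 2 : ℝ) • p.2))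
      (volume.prod volume) (volume.prod volume) := by
  have hA : MeasurePreserving (fun p : E3 × E3 => (p.1, p.2 - (1 / 2 : ℝ) • p.1))
      (volume.prod volume) (volume.prod volume) :=
    (MeasurePreserving.id volume).skew_product (g := fun r u : E3 => u - (1 / 2 : ℝ) • r)
      (Continuous.measurable (by fun_prop))
      (ae_of_all _ fun r => map_sub_right_eq_self _ _)
  have hB : MeasurePreserving (fun p : E3 × E3 => (p.1, p.2 + p.1))
      (volume.prod volume) (volume.prod volume) :=
    (MeasurePreserving.id volume).skew_product (g := fun b r : E3 => r + b)
      (Continuous.measurable (by fun_prop))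
      (ae_of_all _ fun b => map_add_right_eq_self _ _)
  have hS := Measure.measurePreserving_swap (μ := (volume : Measure E3)) (ν := (volume : Measure E3))
  have h := hS.comp (hB.comp (hS.comp (hA.comp hS)))
  convert h using 1
  ext1 p
  simp only [Function.comp_apply, Prod.swap, Prod.mk.injEq, and_true]
  module

lemma measurePreserving_relativeEquiv :
    MeasurePreserving relativeEquiv (volume : Measure H6) (volume : Measure E6) :=
  measurePreserving_shear.comp (WithLp.volume_preserving_ofLp E3 E3)

lemma integral_comp_relativeEquiv {G : Type*} [NormedAddCommGroup G] [NormedSpace ℝ G]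
    (h : E6 → G) : ∫ x, h (relativeEquiv x) = ∫ x, h x :=
  measurePreserving_relativeEquiv.integral_comp
    relativeEquiv.toHomeomorph.measurableEmbedding h

/-- A test function in centre-of-mass coordinates, as a Schwartz function. -/
def relativeSchwartz {φ : E6 → ℂ} (hφ : ContDiff ℝ (⊤ : ℕ∞) φ) (hs : HasCompactSupport φ) :
    SchwartzMap H6 ℂ :=
  (hs.comp_homeomorph relativeEquiv.toHomeomorph).toSchwartzMap
    (hφ.comp relativeEquiv.contDiff)

lemma relativeSchwartz_apply {φ : E6 → ℂ} (hφ : ContDiff ℝ (⊤ : ℕ∞) φ)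
    (hs : HasCompactSupport φ) (x : H6) : relativeSchwartz hφ hs x = φ (relativeEquiv x) := rfl

open LineDeriv

lemma lineDeriv_relativeSchwartz {φ : E6 → ℂ} (hφ : ContDiff ℝ (⊤ : ℕ∞) φ)
    (hs : HasCompactSupport φ) (m x : H6) :
    (∂_{m} (relativeSchwartz hφ hs)) x = fderiv ℝ φ (relativeEquiv x) (relativeEquiv m) := by
  rw [SchwartzMap.lineDerivOp_apply_eq_fderiv]
  exact congrArg (fun L => L m) (relativeEquiv.comp_right_fderiv (f := φ) (x := x))

lemma lineDeriv_lineDeriv_relativeSchwartz {φ : E6 → ℂ} (hφ : ContDiff ℝ (⊤ : ℕ∞) φ)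
    (hs : HasCompactSupport φ) (m n x : H6) :
    (∂_{m} (∂_{n} (relativeSchwartz hφ hs))) x =
      D2 φ (relativeEquiv x) (relativeEquiv m) (relativeEquiv n) := by
  rw [SchwartzMap.lineDerivOp_apply_eq_fderiv]
  have h : ((∂_{n} (relativeSchwartz hφ hs) : SchwartzMap H6 ℂ) : H6 → ℂ) =
      (fun y => fderiv ℝ φ y (relativeEquiv n)) ∘ relativeEquiv :=
    funext fun y => lineDeriv_relativeSchwartz hφ hs n y
  rw [h]
  exact congrArg (fun L => L m) (relativeEquiv.comp_right_fderiv
    (f := fun y => fderiv ℝ φ y (relativeEquiv n)) (x := x))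

/-! ### The energy forms in Fourier space -/

lemma fourier_lineDeriv_apply (f : SchwartzMap H6 ℂ) (m ξ : H6) :
    𝓕 (∂_{m} f) ξ = 2 * Real.pi * Complex.I * (⟪ξ, m⟫ : ℝ) * 𝓕 f ξ := by
  rw [SchwartzMap.fourier_lineDerivOp_eq, _root_.smul_apply,
    SchwartzMap.smulLeftCLM_apply_apply (by fun_prop), smul_eq_mul, Complex.real_smul]
  ring

lemma SchwartzMap.integrable_norm_sq (f : SchwartzMap H6 ℂ) : Integrable fun x => ‖f x‖ ^ 2 :=
  (memLp_two_iff_integrable_sq_norm f.continuous.aestronglyMeasurable).1 (f.memLp 2)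

lemma integrable_energy {ι : Type*} [Fintype ι] (S f : SchwartzMap H6 ℂ)
    (g : ι → SchwartzMap H6 ℂ) :
    Integrable fun x => ‖S x‖ ^ 2 + (∑ i, ‖g i x‖ ^ 2) + ‖f x‖ ^ 2 :=
  (S.integrable_norm_sq.add (integrable_finsetSum _ fun i _ => (g i).integrable_norm_sq)).add
    f.integrable_norm_sq

lemma integral_energy {ι : Type*} [Fintype ι] (S f : SchwartzMap H6 ℂ)
    (g : ι → SchwartzMap H6 ℂ) :
    ∫ x, (‖S x‖ ^ 2 + (∑ i, ‖g i x‖ ^ 2) + ‖f x‖ ^ 2) =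
      (∫ x, ‖S x‖ ^ 2) + (∑ i, ∫ x, ‖g i x‖ ^ 2) + ∫ x, ‖f x‖ ^ 2 := by
  have hg : Integrable fun x => ∑ i, ‖g i x‖ ^ 2 := integrable_finsetSum (μ := (volume : Measure H6)) Finset.univ
    fun i _ => (g i).integrable_norm_sq
  have hSg : Integrable fun x => ‖S x‖ ^ 2 + ∑ i, ‖g i x‖ ^ 2 := S.integrable_norm_sq.add hg
  rw [integral_add hSg f.integrable_norm_sq,
    integral_add S.integrable_norm_sq hg,
    integral_finsetSum _ fun i _ => (g i).integrable_norm_sq]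

lemma integral_energy_fourier {ι : Type*} [Fintype ι] (S f : SchwartzMap H6 ℂ)
    (g : ι → SchwartzMap H6 ℂ) :
    ∫ ξ, (‖𝓕 S ξ‖ ^ 2 + (∑ i, ‖𝓕 (g i) ξ‖ ^ 2) + ‖𝓕 f ξ‖ ^ 2) =
      ∫ x, (‖S x‖ ^ 2 + (∑ i, ‖g i x‖ ^ 2) + ‖f x‖ ^ 2) := by
  rw [integral_energy S f g, integral_energy (𝓕 S) (𝓕 f) fun i => 𝓕 (g i)]
  simp only [SchwartzMap.integral_norm_sq_fourier]

lemma lintegral_energyDensity {A : ℝ → ℝ → ℝ} (hA : Continuous fun p : ℝ × ℝ => A p.1 p.2)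
    (F : SchwartzMap H6 ℂ) :
    ∫⁻ K, energyDensity A F K =
      ∫⁻ ξ : H6, ENNReal.ofReal (A ‖ξ.fst‖ ‖ξ.snd‖) * ‖F ξ‖ₑ ^ 2 := by
  have h1 : Measurable fun p : E3 × E3 => ENNReal.ofReal (A ‖p.1‖ ‖p.2‖) :=
    (hA.comp (f := fun p : E3 × E3 => (‖p.1‖, ‖p.2‖)) (by fun_prop)).measurable.ennreal_ofReal
  have h2 : Measurable fun p : E3 × E3 => ‖F (WithLp.toLp 2 p)‖ₑ ^ 2 :=
    (F.continuous.comp continuous_toLp_E6).enorm.measurable.pow_const 2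
  rw [← volume_preserving_toLp_E6.lintegral_comp_emb measurableEmbedding_toLp_E6]
  exact (lintegral_prod _ (h1.mul h2).aemeasurable).symm

lemma lintegral_energyDensity_le {A : ℝ → ℝ → ℝ} (hA : Continuous fun p : ℝ × ℝ => A p.1 p.2)
    (hA0 : ∀ K r, 0 < A K r) {ι : Type*} [Fintype ι] (S f : SchwartzMap H6 ℂ)
    (g : ι → SchwartzMap H6 ℂ)
    (h : ∀ ξ : H6, A ‖ξ.fst‖ ‖ξ.snd‖ * ‖𝓕 f ξ‖ ^ 2 ≤
      ‖𝓕 S ξ‖ ^ 2 + (∑ i, ‖𝓕 (g i) ξ‖ ^ 2) + ‖𝓕 f ξ‖ ^ 2) :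
    ∫⁻ K, energyDensity A (𝓕 f) K ≤
      ENNReal.ofReal (∫ x, (‖S x‖ ^ 2 + (∑ i, ‖g i x‖ ^ 2) + ‖f x‖ ^ 2)) := by
  rw [lintegral_energyDensity hA, ← integral_energy_fourier,
    ofReal_integral_eq_lintegral_ofReal (integrable_energy (𝓕 S) (𝓕 f) fun i => 𝓕 (g i))
      (ae_of_all _ fun ξ => by positivity)]
  refine lintegral_mono fun ξ => ?_
  rw [← ofReal_norm, ← ENNReal.ofReal_pow (norm_nonneg _), ← ENNReal.ofReal_mul (hA0 _ _).le]
  exact ENNReal.ofReal_le_ofReal (h ξ)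

/-- The centre-of-mass direction. -/
def centreDir (i : Fin 3) : H6 := WithLp.toLp 2 (EuclideanSpace.single i (1 : ℝ), 0)

/-- The direction of opposite displacements of the two particles. -/
def oppositeDir (i : Fin 3) : H6 := WithLp.toLp 2 (0, (2 : ℝ) • EuclideanSpace.single i (1 : ℝ))

/-- The direction of the first particle in centre-of-mass coordinates. -/
def firstDir (i : Fin 3) : H6 :=
  WithLp.toLp 2 ((1 / 2 : ℝ) • EuclideanSpace.single i (1 : ℝ), EuclideanSpace.single i (1 : ℝ))

/-- The direction of the second particle in centre-of-mass coordinates. -/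
def secondDir (i : Fin 3) : H6 :=
  WithLp.toLp 2 ((1 / 2 : ℝ) • EuclideanSpace.single i (1 : ℝ), -EuclideanSpace.single i (1 : ℝ))

lemma relativeEquiv_centreDir (i : Fin 3) : relativeEquiv (centreDir i) = e1 i + e2 i := by
  rw [centreDir, relativeEquiv_toLp, e1, e2, Prod.mk_add_mk]
  congr 1 <;> module

lemma relativeEquiv_oppositeDir (i : Fin 3) : relativeEquiv (oppositeDir i) = e1 i - e2 i := by
  rw [oppositeDir, relativeEquiv_toLp, e1, e2, Prod.mk_sub_mk]
  congr 1 <;> module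

lemma relativeEquiv_firstDir (i : Fin 3) : relativeEquiv (firstDir i) = e1 i := by
  rw [firstDir, relativeEquiv_toLp, e1]
  congr 1 <;> module

lemma relativeEquiv_secondDir (i : Fin 3) : relativeEquiv (secondDir i) = e2 i := by
  rw [secondDir, relativeEquiv_toLp, e2]
  congr 1 <;> module

lemma E3.inner_single (x : E3) (i : Fin 3) : ⟪x, EuclideanSpace.single i (1 : ℝ)⟫ = x i := by
  rw [EuclideanSpace.inner_single_right]
  simp

lemma inner_centreDir (ξ : H6) (i : Fin 3) : ⟪ξ, centreDir i⟫ = ξ.fst i := by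
  simp [centreDir, WithLp.prod_inner_apply, E3.inner_single]

lemma inner_oppositeDir (ξ : H6) (i : Fin 3) : ⟪ξ, oppositeDir i⟫ = 2 * ξ.snd i := by
  simp [oppositeDir, WithLp.prod_inner_apply, inner_smul_right, E3.inner_single]

lemma inner_firstDir (ξ : H6) (i : Fin 3) : ⟪ξ, firstDir i⟫ = ξ.fst i / 2 + ξ.snd i := by
  simp [firstDir, WithLp.prod_inner_apply, inner_smul_right, E3.inner_single]
  ring

lemma inner_secondDir (ξ : H6) (i : Fin 3) : ⟪ξ, secondDir i⟫ = ξ.fst i / 2 - ξ.snd i := by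
  simp [secondDir, WithLp.prod_inner_apply, inner_smul_right, E3.inner_single]
  ring

lemma E3.norm_sq_eq (x : E3) : ‖x‖ ^ 2 = x 0 ^ 2 + x 1 ^ 2 + x 2 ^ 2 := by
  rw [EuclideanSpace.real_norm_sq_eq, Fin.sum_univ_three]

lemma norm_sq_fourier_lineDeriv (f : SchwartzMap H6 ℂ) (m ξ : H6) :
    ‖𝓕 (∂_{m} f) ξ‖ ^ 2 = 4 * Real.pi ^ 2 * ⟪ξ, m⟫ ^ 2 * ‖𝓕 f ξ‖ ^ 2 := by
  rw [fourier_lineDeriv_apply]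
  simp only [norm_mul, Complex.norm_ofNat, Complex.norm_real, Complex.norm_I, mul_pow,
    Real.norm_eq_abs, sq_abs]
  ring

lemma norm_sq_fourier_sum_lineDeriv (f : SchwartzMap H6 ℂ) (m n : Fin 3 → H6) (ξ : H6) :
    ‖𝓕 (∑ i, ∂_{m i} (∂_{n i} f)) ξ‖ ^ 2 =
      16 * Real.pi ^ 4 * (∑ i, ⟪ξ, m i⟫ * ⟪ξ, n i⟫) ^ 2 * ‖𝓕 f ξ‖ ^ 2 := by
  have h : 𝓕 (∑ i, ∂_{m i} (∂_{n i} f)) ξ =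
      ((-4 * Real.pi ^ 2 * ∑ i, ⟪ξ, m i⟫ * ⟪ξ, n i⟫ : ℝ) : ℂ) * 𝓕 f ξ := by
    rw [fourier_sum, _root_.sum_apply]
    simp only [fourier_lineDeriv_apply]
    push_cast
    rw [Finset.mul_sum, Finset.sum_mul]
    refine Finset.sum_congr rfl fun i _ => ?_
    linear_combination (4 * Real.pi ^ 2 * (⟪ξ, m i⟫ : ℂ) * (⟪ξ, n i⟫ : ℂ) * 𝓕 f ξ) *
      Complex.I_sq
  rw [h, norm_mul, Complex.norm_real, mul_pow, Real.norm_eq_abs, sq_abs]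
  ring

lemma one_le_pi_sq : 1 ≤ Real.pi ^ 2 := by nlinarith [Real.pi_gt_three]

lemma lintegral_energyDensity_relSymbol_le {φ : E6 → ℂ} (hφ : ContDiff ℝ (⊤ : ℕ∞) φ)
    (hs : HasCompactSupport φ) :
    ∫⁻ K, energyDensity relSymbol (𝓕 (relativeSchwartz hφ hs)) K ≤
      ENNReal.ofReal (Qrel φ) := by
  set f := relativeSchwartz hφ hs with hf
  have h := lintegral_energyDensity_le continuous_relSymbol relSymbol_pos
    (∑ i, ∂_{oppositeDir i} (∂_{oppositeDir i} f)) f (fun i => ∂_{centreDir i} f) (fun ξ => by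
      rw [norm_sq_fourier_sum_lineDeriv]
      simp only [norm_sq_fourier_lineDeriv, inner_oppositeDir, inner_centreDir]
      have hK := E3.norm_sq_eq ξ.fst
      have hk := E3.norm_sq_eq ξ.snd
      have hp := one_le_pi_sq
      have hcoef : relSymbol ‖ξ.fst‖ ‖ξ.snd‖ ≤
          16 * Real.pi ^ 4 * (4 * ‖ξ.snd‖ ^ 2) ^ 2 + 4 * Real.pi ^ 2 * ‖ξ.fst‖ ^ 2 + 1 := by
        unfold relSymbol
        have hp4 : 1 ≤ Real.pi ^ 4 := by nlinarith
        nlinarith [mul_nonneg (sub_nonneg.2 hp) (sq_nonneg ‖ξ.fst‖),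
          mul_nonneg (sub_nonneg.2 hp4) (sq_nonneg (‖ξ.snd‖ ^ 2)), sq_nonneg ‖ξ.fst‖,
          sq_nonneg (‖ξ.snd‖ ^ 2)]
      refine (mul_le_mul_of_nonneg_right hcoef (sq_nonneg ‖𝓕 f ξ‖)).trans_eq ?_
      rw [hK, hk, Fin.sum_univ_three, Fin.sum_univ_three]
      ring)
  refine h.trans_eq ?_
  congr 1
  rw [Qrel, ← integral_comp_relativeEquiv]
  refine integral_congr_ae (ae_of_all _ fun x => ?_)
  simp only [_root_.sum_apply, hf, lineDeriv_lineDeriv_relativeSchwartz,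
    lineDeriv_relativeSchwartz, relativeEquiv_oppositeDir, relativeEquiv_centreDir,
    relativeSchwartz_apply]

lemma lintegral_energyDensity_mixSymbol_le {ψ : E6 → ℂ} (hψ : ContDiff ℝ (⊤ : ℕ∞) ψ)
    (hs : HasCompactSupport ψ) :
    ∫⁻ K, energyDensity mixSymbol (𝓕 (relativeSchwartz hψ hs)) K ≤
      ENNReal.ofReal (Qmix ψ) := by
  set f := relativeSchwartz hψ hs with hf
  have h := lintegral_energyDensity_le continuous_mixSymbol mixSymbol_pos
    (∑ i, ∂_{firstDir i} (∂_{secondDir i} f)) f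
    (Sum.elim (fun i => ∂_{firstDir i} f) (fun i => ∂_{secondDir i} f)) (fun ξ => by
      rw [norm_sq_fourier_sum_lineDeriv]
      simp only [Fintype.sum_sum_type, Sum.elim_inl, Sum.elim_inr, norm_sq_fourier_lineDeriv,
        inner_firstDir, inner_secondDir]
      have hK := E3.norm_sq_eq ξ.fst
      have hk := E3.norm_sq_eq ξ.snd
      have hp := one_le_pi_sq
      have hcoef : mixSymbol ‖ξ.fst‖ ‖ξ.snd‖ ≤
          16 * Real.pi ^ 4 * (‖ξ.fst‖ ^ 2 / 4 - ‖ξ.snd‖ ^ 2) ^ 2 +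
            4 * Real.pi ^ 2 * (‖ξ.fst‖ ^ 2 / 2 + 2 * ‖ξ.snd‖ ^ 2) + 1 := by
        unfold mixSymbol
        have hp4 : 1 ≤ Real.pi ^ 4 := by nlinarith
        nlinarith [mul_nonneg (sub_nonneg.2 hp) (sq_nonneg ‖ξ.fst‖),
          mul_nonneg (sub_nonneg.2 hp) (sq_nonneg ‖ξ.snd‖),
          mul_nonneg (sub_nonneg.2 hp4) (sq_nonneg (‖ξ.fst‖ ^ 2 / 4 - ‖ξ.snd‖ ^ 2)),
          sq_nonneg ‖ξ.fst‖, sq_nonneg ‖ξ.snd‖,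
          sq_nonneg (‖ξ.fst‖ ^ 2 / 4 - ‖ξ.snd‖ ^ 2)]
      refine (mul_le_mul_of_nonneg_right hcoef (sq_nonneg ‖𝓕 f ξ‖)).trans_eq ?_
      rw [hK, hk, Fin.sum_univ_three, Fin.sum_univ_three, Fin.sum_univ_three]
      ring)
  refine h.trans_eq ?_
  congr 1
  rw [Qmix, ← integral_comp_relativeEquiv]
  refine integral_congr_ae (ae_of_all _ fun x => ?_)
  simp only [_root_.sum_apply, hf, lineDeriv_lineDeriv_relativeSchwartz,
    Fintype.sum_sum_type, Sum.elim_inl, Sum.elim_inr,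
    lineDeriv_relativeSchwartz, relativeEquiv_firstDir, relativeEquiv_secondDir,
    relativeSchwartz_apply]
  ring

/-! ### Approximation of the contact interaction -/

lemma integral_conj_diagonal {φ ψ : E6 → ℂ} (hφ : ContDiff ℝ (⊤ : ℕ∞) φ)
    (hφs : HasCompactSupport φ) (hψ : ContDiff ℝ (⊤ : ℕ∞) ψ) (hψs : HasCompactSupport ψ) :
    ∫ u : E3, conj (φ (u, u)) * ψ (u, u) =
      slicePairing (relativeSchwartz hφ hφs) (relativeSchwartz hψ hψs) 0 := by
  simp only [slicePairing, relativeSchwartz_apply, relativeEquiv_toLp, smul_zero, add_zero,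
    sub_zero]

lemma integrable_interaction {W : E3 → ℝ} (hW : Integrable W) (f g : SchwartzMap H6 ℂ) :
    Integrable (fun p : E3 × E3 => conj (f (WithLp.toLp 2 p)) * (W p.2 : ℂ) *
      g (WithLp.toLp 2 p)) (volume.prod volume) := by
  obtain ⟨C, hC, h⟩ := f.exists_decay_fst
  have hdom : Integrable (fun p : E3 × E3 => (C * (1 + ‖p.1‖) ^ (-4 : ℝ)) *
      (‖W p.2‖ * SchwartzMap.seminorm ℝ 0 0 g)) (volume.prod volume) :=
    (integrable_decay.const_mul C).mul_prod (hW.norm.mul_const _)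
  have hm1 : Continuous fun p : E3 × E3 => conj (f (WithLp.toLp 2 p)) :=
    Complex.continuous_conj.comp (f.continuous.comp continuous_toLp_E6)
  have hm2 : AEStronglyMeasurable (fun p : E3 × E3 => (W p.2 : ℂ)) (volume.prod volume) :=
    Complex.continuous_ofReal.comp_aestronglyMeasurable hW.1.comp_snd
  refine hdom.mono' ((hm1.aestronglyMeasurable.mul hm2).mul
    (g.continuous.comp continuous_toLp_E6).aestronglyMeasurable) (ae_of_all _ fun p => ?_)
  rw [norm_mul, norm_mul, RCLike.norm_conj, Complex.norm_real, mul_assoc]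
  gcongr
  · exact h p.1 p.2
  · exact SchwartzMap.norm_le_seminorm ℝ g _

lemma integral_interaction_inner (W : E3 → ℝ) (f g : SchwartzMap H6 ℂ) (r : E3) :
    ∫ u : E3, conj (f (WithLp.toLp 2 (u, r))) * (W r : ℂ) * g (WithLp.toLp 2 (u, r)) =
      (W r : ℂ) * slicePairing f g r := by
  rw [slicePairing, ← integral_const_mul]
  refine integral_congr_ae (ae_of_all _ fun u => ?_)
  ring

lemma integrable_mul_slicePairing {W : E3 → ℝ} (hW : Integrable W) (f g : SchwartzMap H6 ℂ) :
    Integrable fun r => (W r : ℂ) * slicePairing f g r := by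
  have h := (integrable_interaction hW f g).integral_prod_right
  simpa only [integral_interaction_inner] using h

lemma integral_interaction {W : E3 → ℝ} (hW : Integrable W) {φ ψ : E6 → ℂ}
    (hφ : ContDiff ℝ (⊤ : ℕ∞) φ) (hφs : HasCompactSupport φ) (hψ : ContDiff ℝ (⊤ : ℕ∞) ψ)
    (hψs : HasCompactSupport ψ) :
    ∫ x : E6, conj (φ x) * (W (x.1 - x.2) : ℂ) * ψ x =
      ∫ r, (W r : ℂ) *
        slicePairing (relativeSchwartz hφ hφs) (relativeSchwartz hψ hψs) r := by
  rw [← integral_comp_relativeEquiv,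
    ← volume_preserving_toLp_E6.integral_comp measurableEmbedding_toLp_E6]
  simp only [← integral_interaction_inner]
  rw [← integral_prod_symm _ (integrable_interaction hW _ _)]
  refine integral_congr_ae (ae_of_all _ fun p => ?_)
  have h : (relativeEquiv (WithLp.toLp 2 p)).1 - (relativeEquiv (WithLp.toLp 2 p)).2 = p.2 := by
    rw [relativeEquiv_toLp]
    module
  simp only [h, relativeSchwartz_apply]

lemma continuous_phaseModulus : Continuous phaseModulus := by
  unfold phaseModulus
  fun_prop

lemma sqrt_phaseModulus_le_one (w : E3) : Real.sqrt (phaseModulus w) ≤ 1 :=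
  Real.sqrt_le_one.2 (min_le_left _ _)

lemma integrable_abs_mul_sqrt_phaseModulus {W : E3 → ℝ} (hW : Integrable W) (α : ℝ) :
    Integrable fun r => |W r| * Real.sqrt (phaseModulus (α • r)) := by
  refine hW.abs.mul_bdd (c := 1)
    (continuous_phaseModulus.comp (continuous_const_smul α)).sqrt.aestronglyMeasurable
    (ae_of_all _ fun r => ?_)
  rw [Real.norm_of_nonneg (Real.sqrt_nonneg _)]
  exact sqrt_phaseModulus_le_one _

/-- The rate of convergence of `V_α` to the contact interaction. -/
def contactRate (V : E3 → ℝ) (α : ℝ) : ℝ :=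
  ∫ v, |V v| * Real.sqrt (phaseModulus (α • v))

lemma tendsto_contactRate {V : E3 → ℝ} (hV : Integrable V) :
    Tendsto (contactRate V) (𝓝[>] (0 : ℝ)) (𝓝 0) := by
  have h : Tendsto (contactRate V) (𝓝[>] (0 : ℝ)) (𝓝 (∫ _ : E3, (0 : ℝ))) := by
    refine tendsto_integral_filter_of_dominated_convergence (fun v => |V v|)
      (Eventually.of_forall fun α =>
        (integrable_abs_mul_sqrt_phaseModulus hV α).aestronglyMeasurable)
      (Eventually.of_forall fun α => ae_of_all _ fun v => ?_) hV.abs (ae_of_all _ fun v => ?_)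
    · rw [Real.norm_of_nonneg (by positivity)]
      exact mul_le_of_le_one_right (abs_nonneg _) (sqrt_phaseModulus_le_one _)
    · have hc : Continuous fun α : ℝ => |V v| * Real.sqrt (phaseModulus (α • v)) :=
        continuous_const.mul
          (continuous_phaseModulus.comp (continuous_id.smul continuous_const)).sqrt
      have h0 := (hc.tendsto 0).mono_left (nhdsWithin_le_nhds (s := Set.Ioi (0 : ℝ)))
      simpa [phaseModulus] using h0
  simpa using h

lemma integral_comp_inv_smul_E3 (h : E3 → ℝ) {α : ℝ} (hα : 0 < α) :
    ∫ x, α ^ (-3 : ℤ) * h (α⁻¹ • x) = ∫ x, h x := by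
  rw [integral_const_mul, Measure.integral_comp_inv_smul, finrank_euclideanSpace_fin,
    abs_of_pos (by positivity), smul_eq_mul, ← mul_assoc, zpow_neg]
  rw [show (3 : ℤ) = ((3 : ℕ) : ℤ) from rfl, zpow_natCast,
    inv_mul_cancel₀ (by positivity), one_mul]

lemma integrable_rescaled {V : E3 → ℝ} (hV : Integrable V) {α : ℝ} (hα : 0 < α) :
    Integrable fun x => α ^ (-3 : ℤ) * V (α⁻¹ • x) :=
  (hV.comp_smul (inv_ne_zero hα.ne')).const_mul _

lemma integral_rescaled_eq_contactRate (V : E3 → ℝ) {α : ℝ} (hα : 0 < α) :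
    ∫ x, |α ^ (-3 : ℤ) * V (α⁻¹ • x)| * Real.sqrt (phaseModulus x) = contactRate V α := by
  rw [contactRate, ← integral_comp_inv_smul_E3 (fun v => |V v| * _) hα]
  refine integral_congr_ae (ae_of_all _ fun x => ?_)
  simp only [smul_inv_smul₀ hα.ne', abs_mul]
  rw [abs_of_pos (zpow_pos hα _), mul_assoc]

lemma norm_interaction_sub_contact_le {W : E3 → ℝ} (hW : Integrable W) (hW1 : ∫ r, W r = 1)
    {φ ψ : E6 → ℂ} (hφ : ContDiff ℝ (⊤ : ℕ∞) φ) (hφs : HasCompactSupport φ)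
    (hψ : ContDiff ℝ (⊤ : ℕ∞) ψ) (hψs : HasCompactSupport ψ) :
    ‖(∫ x : E6, conj (φ x) * (W (x.1 - x.2) : ℂ) * ψ x)
        - ∫ u : E3, conj (φ (u, u)) * ψ (u, u)‖ ≤
      2 * Real.sqrt holderConst * (∫ r, |W r| * Real.sqrt (phaseModulus r)) *
        Real.sqrt (Qmix ψ) * Real.sqrt (Qrel φ) := by
  set f := relativeSchwartz hφ hφs
  set g := relativeSchwartz hψ hψs
  have h0 : slicePairing f g 0 = ∫ r, (W r : ℂ) * slicePairing f g 0 := by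
    rw [integral_mul_const, integral_complex_ofReal, hW1, Complex.ofReal_one, one_mul]
  have hint : Integrable fun r => |W r| * Real.sqrt (phaseModulus r) := by
    simpa only [one_smul] using integrable_abs_mul_sqrt_phaseModulus hW 1
  rw [integral_interaction hW hφ hφs hψ hψs, integral_conj_diagonal hφ hφs hψ hψs]
  change ‖(∫ r, (W r : ℂ) * slicePairing f g r) - slicePairing f g 0‖ ≤ _
  have hconst : Integrable fun r => (W r : ℂ) * slicePairing f g 0 := hW.ofReal.mul_const _
  rw [h0, ← integral_sub (integrable_mul_slicePairing hW f g) hconst]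
  have hb := norm_integral_le_of_norm_le (μ := volume)
    (f := fun r => (W r : ℂ) * slicePairing f g r - (W r : ℂ) * slicePairing f g 0)
    (hint.const_mul (2 * Real.sqrt holderConst * Real.sqrt (Qmix ψ) * Real.sqrt (Qrel φ)))
    (ae_of_all _ fun r => by
      rw [← mul_sub, norm_mul, Complex.norm_real, Real.norm_eq_abs]
      refine (mul_le_mul_of_nonneg_left (norm_slicePairing_sub_le f g
        (lintegral_energyDensity_relSymbol_le hφ hφs)
        (lintegral_energyDensity_mixSymbol_le hψ hψs) r) (abs_nonneg _)).trans_eq ?_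
      ring)
  refine hb.trans_eq ?_
  rw [integral_const_mul]
  ring

/-- Let `V ∈ L¹(ℝ³)` with `∫V = 1` and `V_α(x) = α⁻³V(x/α)`.  Then there is
`β_α → 0` as `α → 0⁺` such that for all (smooth, compactly supported) `φ, ψ`:
`|⟨φ, (V_α(x₁−x₂) − δ(x₁−x₂))ψ⟩| ≤ C β_α ⟨ψ, ((∇₁·∇₂)²−Δ₁−Δ₂+1)ψ⟩^{1/2}
⟨φ, ((∇₁−∇₂)⁴+(∇₁+∇₂)²+1)φ⟩^{1/2}` with a universal constant `C`. -/
theorem stmt_12 :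
    ∃ C : ℝ, 0 < C ∧
    ∀ V : E3 → ℝ, Integrable V → (∫ v, V v) = 1 →
    ∃ β : ℝ → ℝ, Tendsto β (𝓝[>] (0 : ℝ)) (𝓝 0) ∧
      ∀ α : ℝ, 0 < α →
      ∀ φ ψ : E6 → ℂ,
        ContDiff ℝ (⊤ : ℕ∞) φ → HasCompactSupport φ →
        ContDiff ℝ (⊤ : ℕ∞) ψ → HasCompactSupport ψ →
        ‖(∫ x : E6, conj (φ x) * ((α ^ (-3 : ℤ) * V (α⁻¹ • (x.1 - x.2)) : ℝ) : ℂ) * ψ x)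
            - ∫ u : E3, conj (φ (u, u)) * ψ (u, u)‖ ≤
          C * β α * Real.sqrt (Qmix ψ) * Real.sqrt (Qrel φ) := by
  refine ⟨2 * Real.sqrt holderConst + 1, by positivity, fun V hV hV1 =>
    ⟨contactRate V, tendsto_contactRate hV, fun α hα φ ψ hφ hφs hψ hψs => ?_⟩⟩
  have h := norm_interaction_sub_contact_le (integrable_rescaled hV hα)
    ((integral_comp_inv_smul_E3 V hα).trans hV1) hφ hφs hψ hψs
  rw [integral_rescaled_eq_contactRate V hα] at h
  have hβ : 0 ≤ contactRate V α := integral_nonneg fun v => by positivity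
  refine h.trans ?_
  gcongr
  linarith

end
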